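/- arXiv:1705.09588 — 12 statements merged into one kernel-verified Lean document; each statement's English description precedes it below -/
import Mathlib

section
/- Let C = {(x, y) ∈ E × E : s(x) = r(y)}, and let M : C → E be any K-linear map satisfying the unit laws M(x, s(x)) = x and M(r(y), y) = y for all x, y ∈ E. Then M(x, y) = x + y − s(x) for every (x, y) ∈ C. (This is the paper's claim that, given E, F and the linear retractions r, s, the linear groupoid product x·y = x + y − s(x) is the only possible linear groupoid composition on E with units F, range r and source s.) -/
/-- Uniqueness of the linear groupoid product: if `M` is `K`-linear on the subspace
`C = {(x,y) : s x = r y}` of composable pairs and satisfies the unit laws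
`M (x, s x) = x` and `M (r y, y) = y`, then `M (x, y) = x + y - s x` on `C`. -/
theorem stmt_2 (K : Type*) [Field K] (E : Type*) [AddCommGroup E] [Module K E]
    (F : Submodule K E) (r s : E →ₗ[K] E)
    (hr : ∀ x : E, r x ∈ F) (hs : ∀ x : E, s x ∈ F)
    (hrF : ∀ f ∈ F, r f = f) (hsF : ∀ f ∈ F, s f = f)
    (M : E × E → E)
    (hadd : ∀ p q : E × E, s p.1 = r p.2 → s q.1 = r q.2 → M (p + q) = M p + M q)
    (hsmul : ∀ (c : K) (p : E × E), s p.1 = r p.2 → M (c • p) = c • M p)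
    (hunit₁ : ∀ x : E, M (x, s x) = x)
    (hunit₂ : ∀ y : E, M (r y, y) = y) :
    ∀ x y : E, s x = r y → M (x, y) = x + y - s x := by
  intro x y h
  have hker : s (x - s x) = 0 := by rw [map_sub, hsF _ (hs x), sub_self]
  have hleft : M (x - s x, 0) = x - s x := by
    simpa only [hker] using hunit₁ (x - s x)
  have hright : M (s x, y) = y := by
    rw [h]
    exact hunit₂ y
  have hsum := hadd (x - s x, 0) (s x, y) (by simpa only [map_zero] using hker)
    (by simpa only [hsF _ (hs x)] using h)
  rw [Prod.mk_add_mk, sub_add_cancel, zero_add, hleft, hright] at hsum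
  rw [hsum]
  abel
end

section
/- For every u ∈ E with r(u) ≠ 0 and s(u) ≠ 0 there is a unique scalar h(u) ∈ K, necessarily nonzero, with r(u) = h(u)·s(u); it satisfies h(λu) = h(u) for every nonzero λ ∈ K, so h depends only on the line spanned by u. Moreover h is multiplicative for the linear groupoid product: if u, v ∈ E satisfy s(u) = r(v) and r(u), s(u), r(v), s(v) are all nonzero, then w := u·v = u + v − s(u) satisfies r(w) ≠ 0, s(w) ≠ 0 and h(w) = h(u)·h(v). -/
/-- Assume `F` is one-dimensional. For `u ∈ E` with `r u ≠ 0` and `s u ≠ 0` there is a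
unique scalar `c` with `r u = c • s u`; it is nonzero, invariant under replacing `u` by a
nonzero scalar multiple, and multiplicative for the linear groupoid product
`u·v = u + v - s u` (defined when `s u = r v`). -/
theorem stmt_5 (K : Type*) [Field K] (E : Type*) [AddCommGroup E] [Module K E]
    (F : Submodule K E) (r s : E →ₗ[K] E)
    (hr : ∀ x : E, r x ∈ F) (hs : ∀ x : E, s x ∈ F)
    (hrF : ∀ f ∈ F, r f = f) (hsF : ∀ f ∈ F, s f = f)
    (hF : Module.finrank K F = 1) :
    (∀ u : E, r u ≠ 0 → s u ≠ 0 → ∃! c : K, r u = c • s u) ∧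
    (∀ (u : E) (c : K), r u ≠ 0 → s u ≠ 0 → r u = c • s u → c ≠ 0) ∧
    (∀ (u : E) (c lam : K), lam ≠ 0 → r u ≠ 0 → s u ≠ 0 → r u = c • s u →
      r (lam • u) ≠ 0 ∧ s (lam • u) ≠ 0 ∧ r (lam • u) = c • s (lam • u)) ∧
    (∀ (u v : E) (a b : K), s u = r v →
      r u ≠ 0 → s u ≠ 0 → r v ≠ 0 → s v ≠ 0 →
      r u = a • s u → r v = b • s v →
      r (u + v - s u) ≠ 0 ∧ s (u + v - s u) ≠ 0 ∧
        r (u + v - s u) = (a * b) • s (u + v - s u)) := by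
  refine ⟨fun u _ hsu => ?_, ?_, ?_, ?_⟩
  · have hne : (⟨s u, hs u⟩ : F) ≠ 0 := fun h => hsu (congrArg Subtype.val h)
    obtain ⟨c, hc⟩ := (finrank_eq_one_iff_of_nonzero' _ hne).mp hF ⟨r u, hr u⟩
    have hc' : r u = c • s u := (congrArg Subtype.val hc).symm
    exact ⟨c, hc', fun d hd => smul_left_injective K hsu (hd.symm.trans hc')⟩
  · rintro u c hru - h rfl
    exact hru (by rw [h, zero_smul])
  · intro u c lam hlam hru hsu h
    simp only [map_smul]
    exact ⟨smul_ne_zero hlam hru, smul_ne_zero hlam hsu, by rw [h, smul_comm]⟩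
  · intro u v a b huv hru _ _ hsv hu hv
    have hrw : r (u + v - s u) = r u := by
      rw [map_sub, map_add, hrF _ (hs u), huv, add_sub_cancel_right]
    have hsw : s (u + v - s u) = s v := by
      rw [map_sub, map_add, hsF _ (hs u), add_sub_cancel_left]
    rw [hrw, hsw]
    exact ⟨hru, hsv, by rw [hu, huv, hv, mul_smul]⟩
end

section
/- For every u ∈ ker r ∩ ker s the vector w + u is nonzero, and the map u ↦ [w + u] is a bijection from ker r ∩ ker s onto the set of lines ℓ ∈ ℙ(E) with ℓ ⊆ ker(r − s) and ℓ ⊄ ker r. Moreover it transforms addition into the linear groupoid product: for u, u' ∈ ker r ∩ ker s one has s(w + u) = w = r(w + u') and (w + u)·(w + u') = w + (u + u'). -/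
/-- Assume `F = K·w` with `w ≠ 0`. For `u ∈ ker r ∩ ker s` the vector `w + u` is nonzero,
and `u ↦ span {w + u}` is a bijection from `ker r ∩ ker s` onto the set of lines contained
in `ker (r - s)` but not in `ker r`. Moreover it transforms addition into the linear
groupoid product: `s (w + u) = w = r (w + u')` and
`(w + u)·(w + u') = w + (u + u')`. -/
theorem stmt_6 (K : Type*) [Field K] (E : Type*) [AddCommGroup E] [Module K E]
    (F : Submodule K E) (r s : E →ₗ[K] E)
    (hr : ∀ x : E, r x ∈ F) (hs : ∀ x : E, s x ∈ F)
    (hrF : ∀ f ∈ F, r f = f) (hsF : ∀ f ∈ F, s f = f)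
    (w : E) (hw : w ≠ 0) (hF : F = Submodule.span K {w}) :
    (∀ u ∈ LinearMap.ker r ⊓ LinearMap.ker s, w + u ≠ 0) ∧
    Set.BijOn (fun u : E => Submodule.span K {w + u})
      ↑(LinearMap.ker r ⊓ LinearMap.ker s)
      {ℓ : Submodule K E | (∃ v : E, v ≠ 0 ∧ ℓ = Submodule.span K {v}) ∧
        ℓ ≤ LinearMap.ker (r - s) ∧ ¬ ℓ ≤ LinearMap.ker r} ∧
    (∀ u ∈ LinearMap.ker r ⊓ LinearMap.ker s,
      ∀ u' ∈ LinearMap.ker r ⊓ LinearMap.ker s,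
      s (w + u) = w ∧ r (w + u') = w ∧
        (w + u) + (w + u') - s (w + u) = w + (u + u')) := by
  have hwF : w ∈ F := hF ▸ Submodule.mem_span_singleton_self w
  have hrw : r w = w := hrF w hwF
  have hsw : s w = w := hsF w hwF
  have hru : ∀ u ∈ LinearMap.ker r ⊓ LinearMap.ker s, r (w + u) = w := fun u hu => by
    rw [map_add, hrw, LinearMap.mem_ker.mp hu.1, add_zero]
  have hsu : ∀ u ∈ LinearMap.ker r ⊓ LinearMap.ker s, s (w + u) = w := fun u hu => by
    rw [map_add, hsw, LinearMap.mem_ker.mp hu.2, add_zero]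
  have hne : ∀ u ∈ LinearMap.ker r ⊓ LinearMap.ker s, w + u ≠ 0 := fun u hu h =>
    hw (by rw [← hru u hu, h, map_zero])
  refine ⟨hne, ⟨?_, ?_, ?_⟩, fun u hu u' hu' => ⟨hsu u hu, hru u' hu', ?_⟩⟩
  · intro u hu
    refine ⟨⟨w + u, hne u hu, rfl⟩, ?_, fun h => ?_⟩
    · rw [Submodule.span_singleton_le_iff_mem, LinearMap.mem_ker, LinearMap.sub_apply,
        hru u hu, hsu u hu, sub_self]
    · rw [Submodule.span_singleton_le_iff_mem, LinearMap.mem_ker, hru u hu] at h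
      exact hw h
  · intro u hu u' hu' h
    have hmem : w + u ∈ Submodule.span K {w + u'} :=
      (show Submodule.span K {w + u} = Submodule.span K {w + u'} from h) ▸
        Submodule.mem_span_singleton_self (w + u)
    obtain ⟨a, ha⟩ := Submodule.mem_span_singleton.mp hmem
    have haw : a • w = (1 : K) • w := by
      calc a • w = r (a • (w + u')) := by rw [map_smul, hru u' hu']
        _ = (1 : K) • w := by rw [ha, hru u hu, one_smul]
    rw [smul_left_injective K hw haw, one_smul] at ha
    exact (add_left_cancel ha).symm
  · rintro ℓ ⟨⟨v, -, rfl⟩, hrs, hnr⟩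
    rw [Submodule.span_singleton_le_iff_mem, LinearMap.mem_ker] at hrs hnr
    rw [LinearMap.sub_apply, sub_eq_zero] at hrs
    have hrv := hr v
    rw [hF] at hrv
    obtain ⟨c, hc⟩ := Submodule.mem_span_singleton.mp hrv
    have hc0 : c ≠ 0 := by
      rintro rfl
      exact hnr (by rw [← hc, zero_smul])
    refine ⟨c⁻¹ • v - w, ⟨?_, ?_⟩, ?_⟩
    · simp [hrw, ← hc, smul_smul, hc0]
    · simp [hsw, ← hrs, ← hc, smul_smul, hc0]
    · simpa using Submodule.span_singleton_smul_eq (inv_ne_zero hc0).isUnit v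
  · rw [hsu u hu]
    abel
end

section
/- Suppose in addition that v ∈ E satisfies r(v) ≠ s(v). Then w and v are linearly independent, and for every nonzero scalar c ∈ K there is exactly one line ℓ contained in the plane span{w, v} such that ℓ ⊄ ker r, ℓ ⊄ ker s, and r(u) = c·s(u) for every u ∈ ℓ. (This is the paper's claim that when r ≠ s the plane F ⊕ K·v defines a section of the canonical morphism h with values in K*.) -/
/-- Assume `F = K·w` with `w ≠ 0`, and let `v ∈ E` satisfy `r v ≠ s v`. Then `w, v` are
linearly independent, and for every nonzero scalar `c` there is exactly one line `ℓ`
contained in the plane `span {w, v}` with `ℓ ⊄ ker r`, `ℓ ⊄ ker s` and `r u = c • s u`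
for every `u ∈ ℓ`. -/
theorem stmt_7 (K : Type*) [Field K] (E : Type*) [AddCommGroup E] [Module K E]
    (F : Submodule K E) (r s : E →ₗ[K] E)
    (hr : ∀ x : E, r x ∈ F) (hs : ∀ x : E, s x ∈ F)
    (hrF : ∀ f ∈ F, r f = f) (hsF : ∀ f ∈ F, s f = f)
    (w : E) (hw : w ≠ 0) (hF : F = Submodule.span K {w})
    (v : E) (hv : r v ≠ s v) :
    LinearIndependent K ![w, v] ∧
    ∀ c : K, c ≠ 0 → ∃! ℓ : Submodule K E,
      (∃ z : E, z ≠ 0 ∧ ℓ = Submodule.span K {z}) ∧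
      ℓ ≤ Submodule.span K {w, v} ∧
      ¬ ℓ ≤ LinearMap.ker r ∧ ¬ ℓ ≤ LinearMap.ker s ∧
      ∀ u ∈ ℓ, r u = c • s u := by
  subst hF
  have hwF : w ∈ Submodule.span K {w} := Submodule.mem_span_singleton_self w
  have hrw : r w = w := hrF w hwF
  have hsw : s w = w := hsF w hwF
  obtain ⟨a, ha⟩ := Submodule.mem_span_singleton.1 (hr v)
  obtain ⟨b, hb⟩ := Submodule.mem_span_singleton.1 (hs v)
  have hab : b - a ≠ 0 := by
    intro h
    apply hv
    rw [← ha, ← hb, sub_eq_zero.1 h]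
  have hr_comb : ∀ x y : K, r (x • w + y • v) = (x + y * a) • w := by
    intro x y
    rw [map_add, map_smul, map_smul, hrw, ← ha, smul_smul, add_smul]
  have hs_comb : ∀ x y : K, s (x • w + y • v) = (x + y * b) • w := by
    intro x y
    rw [map_add, map_smul, map_smul, hsw, ← hb, smul_smul, add_smul]
  refine ⟨?_, fun c hc => ?_⟩
  · rw [LinearIndependent.pair_iff' hw]
    rintro x rfl
    exact hv (by rw [map_smul, map_smul, hrw, hsw])
  set z₀ : E := (c * b - a) • w + (1 - c) • v with hz₀
  have hrz : r z₀ = (c * (b - a)) • w := by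
    rw [hz₀, hr_comb]
    congr 1
    ring
  have hsz : s z₀ = (b - a) • w := by
    rw [hz₀, hs_comb]
    congr 1
    ring
  have hsz_ne : s z₀ ≠ 0 := hsz ▸ smul_ne_zero hab hw
  have hrz_ne : r z₀ ≠ 0 := hrz ▸ smul_ne_zero (mul_ne_zero hc hab) hw
  have hz₀_mem : z₀ ∈ Submodule.span K {z₀} := Submodule.mem_span_singleton_self z₀
  refine ⟨Submodule.span K {z₀}, ⟨⟨z₀, ?_, rfl⟩, ?_, ?_, ?_, ?_⟩, ?_⟩
  · intro h
    exact hsz_ne (by rw [h, map_zero])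
  · rw [Submodule.span_singleton_le_iff_mem]
    exact Submodule.mem_span_pair.2 ⟨_, _, rfl⟩
  · exact fun h => hrz_ne (h hz₀_mem)
  · exact fun h => hsz_ne (h hz₀_mem)
  · intro u hu
    obtain ⟨t, rfl⟩ := Submodule.mem_span_singleton.1 hu
    rw [map_smul, map_smul, hrz, hsz, mul_smul, smul_comm t c]
  · rintro ℓ ⟨⟨z, hz, rfl⟩, hle, -, -, heq⟩
    have hz_mem := Submodule.mem_span_singleton_self (R := K) z
    obtain ⟨x, y, rfl⟩ := Submodule.mem_span_pair.1 (hle hz_mem)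
    have hxy := heq _ hz_mem
    rw [hr_comb, hs_comb, smul_smul] at hxy
    replace hxy : x + y * a = c * (x + y * b) := smul_left_injective K hw hxy
    have hmul : x • w + y • v = ((x + y * b) / (b - a)) • z₀ := by
      rw [hz₀, smul_add, smul_smul, smul_smul]
      congr 2
      · field_simp
        linear_combination b * hxy
      · field_simp
        linear_combination -hxy
    rw [hmul] at hz ⊢
    exact Submodule.span_singleton_smul_eq (IsUnit.mk0 _ (left_ne_zero_of_smul hz)) z₀
end

section
/- The following are equivalent: (i) the linear map x ↦ (r(x), s(x)) from E to F × F is surjective; (ii) r(ker s) = F; (iii) the range of r − s equals F. -/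
/-- If `r` fixes the range of an idempotent `s`, then `r` maps `ker s` onto the range of `r - s`. -/
theorem LinearMap.map_ker_eq_range_sub {R M : Type*} [Ring R] [AddCommGroup M] [Module R M]
    (r s : M →ₗ[R] M) (hrs : ∀ x, r (s x) = s x) (hss : ∀ x, s (s x) = s x) :
    Submodule.map r (LinearMap.ker s) = LinearMap.range (r - s) := by
  ext y
  constructor
  · rintro ⟨x, hx, rfl⟩
    have hx : s x = 0 := hx
    exact ⟨x, by simp [hx]⟩
  · rintro ⟨x, rfl⟩
    exact ⟨x - s x, by simp [hss], by simp [hrs]⟩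


/-- The following are equivalent: (i) `x ↦ (r x, s x)` maps `E` onto `F × F`;
(ii) `r(ker s) = F`; (iii) the range of `r - s` equals `F`. -/
theorem stmt_9 (K : Type*) [Field K] (E : Type*) [AddCommGroup E] [Module K E]
    (F : Submodule K E) (r s : E →ₗ[K] E)
    (hr : ∀ x : E, r x ∈ F) (hs : ∀ x : E, s x ∈ F)
    (hrF : ∀ f ∈ F, r f = f) (hsF : ∀ f ∈ F, s f = f) :
    ((∀ f ∈ F, ∀ g ∈ F, ∃ x : E, r x = f ∧ s x = g) ↔
      Submodule.map r (LinearMap.ker s) = F) ∧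
    (Submodule.map r (LinearMap.ker s) = F ↔ LinearMap.range (r - s) = F) := by
  constructor
  · constructor
    · intro h
      apply le_antisymm
      · rintro _ ⟨x, -, rfl⟩
        exact hr x
      · intro f hf
        obtain ⟨x, hx, hx'⟩ := h f hf 0 F.zero_mem
        exact ⟨x, hx', hx⟩
    · intro h f hf g hg
      obtain ⟨x, hx, hx'⟩ : f - g ∈ Submodule.map r (LinearMap.ker s) := h ▸ F.sub_mem hf hg
      have hx : s x = 0 := hx
      exact ⟨x + g, by simp [hx', hrF g hg], by simp [hx, hsF g hg]⟩
  · rw [LinearMap.map_ker_eq_range_sub r s (fun x => hrF _ (hs x)) (fun x => hsF _ (hs x))]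
end

section
/- Let x, y, z ∈ E with s(x) = r(y) and s(y) = r(z). Then the product (x·y)·z belongs to F if and only if x + y + z = s(x) + s(y) + s(z); and in that case s(z) = r(x) and (x·y)·z = r(x). Consequently the set of triples of the linear groupoid composing to a unit is {(x, y, z) ∈ E³ : s(x) = r(y), s(y) = r(z), x + y + z = s(x) + s(y) + s(z)}. -/
/-- For `x, y, z` with `s x = r y` and `s y = r z`, the product `(x·y)·z` lies in `F` iff
`x + y + z = s x + s y + s z`; in that case `s z = r x` and `(x·y)·z = r x`. Consequently
the set of triples composing to a unit is
`{(x,y,z) : s x = r y, s y = r z, x + y + z = s x + s y + s z}`. -/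
theorem stmt_10 (K : Type*) [Field K] (E : Type*) [AddCommGroup E] [Module K E]
    (F : Submodule K E) (r s : E →ₗ[K] E)
    (hr : ∀ x : E, r x ∈ F) (hs : ∀ x : E, s x ∈ F)
    (hrF : ∀ f ∈ F, r f = f) (hsF : ∀ f ∈ F, s f = f) :
    (∀ x y z : E, s x = r y → s y = r z →
      (((x + y - s x) + z - s (x + y - s x)) ∈ F ↔
        x + y + z = s x + s y + s z)) ∧
    (∀ x y z : E, s x = r y → s y = r z → x + y + z = s x + s y + s z →
      s z = r x ∧ (x + y - s x) + z - s (x + y - s x) = r x) ∧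
    {t : E × E × E | s t.1 = r t.2.1 ∧ s t.2.1 = r t.2.2 ∧
        ((t.1 + t.2.1 - s t.1) + t.2.2 - s (t.1 + t.2.1 - s t.1)) ∈ F} =
      {t : E × E × E | s t.1 = r t.2.1 ∧ s t.2.1 = r t.2.2 ∧
        t.1 + t.2.1 + t.2.2 = s t.1 + s t.2.1 + s t.2.2} := by
  have hprod (x y z : E) :
      (x + y - s x) + z - s (x + y - s x) = x + y + z - s x - s y := by
    simp only [map_add, map_sub, hsF _ (hs x)]
    abel
  have hiff (x y z : E) : ((x + y - s x) + z - s (x + y - s x)) ∈ F ↔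
      x + y + z = s x + s y + s z := by
    rw [hprod]
    constructor
    · intro h
      have hfix := hsF _ h
      simp only [map_add, map_sub, hsF _ (hs x), hsF _ (hs y)] at hfix
      rw [sub_left_inj, sub_left_inj] at hfix
      exact hfix.symm
    · intro h
      have hz : x + y + z - s x - s y = s z := by rw [h]; abel
      exact hz ▸ hs z
  refine ⟨fun x y z _ _ => hiff x y z, fun x y z hxy hyz h => ?_, ?_⟩
  · have hz : s z = r x := by
      have hr_sum := congrArg r h
      simp only [map_add, hrF _ (hs _), ← hxy, ← hyz] at hr_sum
      rw [add_assoc, add_comm, add_right_inj] at hr_sum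
      exact hr_sum.symm
    exact ⟨hz, by rw [hprod, h, ← hz]; abel⟩
  · ext t
    simp only [Set.mem_ofPred_eq, hiff]
end

section
/- Assume E is finite-dimensional over K. Then the annihilator of U³(E, F, r, s) in (E*)³, with respect to the pairing ((x, y, z), (ξ, η, ζ)) ↦ ξ(x) + η(y) + ζ(z), equals {(ξ, η, ζ) ∈ (E*)³ : ξ − ξ∘r = η − η∘s, η − η∘r = ζ − ζ∘s, and (ξ + η + ζ)(f) = 0 for all f ∈ F}; equivalently, it equals U³(E*, F⁰, ρ, σ), the corresponding set of triples for the dual space E*, the subspace F⁰, and the dual retractions ρ(ξ) = ξ − ξ∘s (playing the role of the range retraction) and σ(ξ) = ξ − ξ∘r (playing the role of the source retraction). (This is the linear core, over a single unit, of the paper's theorem that the dual of a VB-groupoid E satisfies Uᵏ(E*) = Uᵏ(E)^⊥.) -/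
/-- For finite-dimensional `E`, the annihilator of the set `U³(E,F,r,s)` of triples of the
linear groupoid composing to a unit, with respect to the pairing
`((x,y,z),(ξ,η,ζ)) ↦ ξ x + η y + ζ z`, equals the explicitly described set
`{(ξ,η,ζ) : ξ - ξ∘r = η - η∘s, η - η∘r = ζ - ζ∘s, (ξ+η+ζ)|_F = 0}`, which is
`U³(E*, F⁰, ρ, σ)` for the dual retractions `ρ(ξ) = ξ - ξ∘s` (range) and
`σ(ξ) = ξ - ξ∘r` (source). -/
theorem stmt_11 (K : Type*) [Field K] (E : Type*) [AddCommGroup E] [Module K E]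
    [FiniteDimensional K E]
    (F : Submodule K E) (r s : E →ₗ[K] E)
    (hr : ∀ x : E, r x ∈ F) (hs : ∀ x : E, s x ∈ F)
    (hrF : ∀ f ∈ F, r f = f) (hsF : ∀ f ∈ F, s f = f) :
    let U3 : Set (E × E × E) :=
      {t | s t.1 = r t.2.1 ∧ s t.2.1 = r t.2.2 ∧
        t.1 + t.2.1 + t.2.2 = s t.1 + s t.2.1 + s t.2.2}
    let Ann : Set (Module.Dual K E × Module.Dual K E × Module.Dual K E) :=
      {ξ | ∀ t ∈ U3, ξ.1 t.1 + ξ.2.1 t.2.1 + ξ.2.2 t.2.2 = 0}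
    let ρ : Module.Dual K E → Module.Dual K E := fun ξ => ξ - ξ ∘ₗ s
    let σ : Module.Dual K E → Module.Dual K E := fun ξ => ξ - ξ ∘ₗ r
    (Ann = {ξ | (∀ x : E, ξ.1 x - ξ.1 (r x) = ξ.2.1 x - ξ.2.1 (s x)) ∧
        (∀ x : E, ξ.2.1 x - ξ.2.1 (r x) = ξ.2.2 x - ξ.2.2 (s x)) ∧
        ∀ f ∈ F, ξ.1 f + ξ.2.1 f + ξ.2.2 f = 0}) ∧
    Ann = {ξ | σ ξ.1 = ρ ξ.2.1 ∧ σ ξ.2.1 = ρ ξ.2.2 ∧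
        ξ.1 + ξ.2.1 + ξ.2.2 = σ ξ.1 + σ ξ.2.1 + σ ξ.2.2} := by
  intro U3 Ann ρ σ
  have hrr (x : E) : r (r x) = r x := hrF _ (hr x)
  have hrs (x : E) : r (s x) = s x := hrF _ (hs x)
  have hsr (x : E) : s (r x) = r x := hsF _ (hr x)
  have hss (x : E) : s (s x) = s x := hsF _ (hs x)
  have hAnn : Ann = {ξ | (∀ x : E, ξ.1 x - ξ.1 (r x) = ξ.2.1 x - ξ.2.1 (s x)) ∧
      (∀ x : E, ξ.2.1 x - ξ.2.1 (r x) = ξ.2.2 x - ξ.2.2 (s x)) ∧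
      ∀ f ∈ F, ξ.1 f + ξ.2.1 f + ξ.2.2 f = 0} := by
    ext ⟨ξ, η, ζ⟩
    simp only [Ann, Set.mem_ofPred_eq]
    constructor
    · intro h
      refine ⟨fun x => ?_, fun x => ?_, fun f hf => ?_⟩
      · have := h (x - r x, s x - x, 0) (by simp [U3, hrs, hsr, hss])
        simp only [map_sub, map_zero] at this
        linear_combination this
      · have := h (0, x - r x, s x - x) (by simp [U3, hrr, hrs, hsr, hss])
        simp only [map_sub, map_zero] at this
        linear_combination this
      · exact h (f, f, f) (by simp [U3, hrF f hf, hsF f hf])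
    · rintro ⟨h₁, h₂, h₃⟩ ⟨x, y, z⟩ ⟨hxy, hyz, hsum⟩
      dsimp only at hxy hyz hsum ⊢
      have hzx : s z = r x := by
        have := congrArg r hsum
        simp only [map_add, hrs] at this
        rw [← hxy, ← hyz] at this
        linear_combination (norm := module) -this
      have hz : z = s x + s y + r x - x - y := by
        rw [hzx] at hsum
        linear_combination (norm := module) hsum
      have e₁ := h₁ x
      have e₂ := h₂ (x + y - s x)
      have e₃ := h₃ (r x) (hr x)
      simp only [map_add, map_sub, hrs, hss, ← hxy] at e₂
      rw [hz]
      simp only [map_add, map_sub]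
      linear_combination e₁ + e₂ + e₃
  refine ⟨hAnn, hAnn.trans ?_⟩
  ext ⟨ξ, η, ζ⟩
  simp only [ρ, σ, Set.mem_ofPred_eq, LinearMap.ext_iff, LinearMap.sub_apply,
    LinearMap.add_apply, LinearMap.comp_apply]
  refine and_congr_right fun _ => and_congr_right fun _ => ⟨fun h x => ?_, fun h f hf => ?_⟩
  · linear_combination h (r x) (hr x)
  · have := h f
    rw [hrF f hf] at this
    linear_combination this
end

section
/- Define ι : E → E by ι(x) = r(x) + s(x) − x and ι* : E* → E* by ι*(ξ) = ξ − ξ∘r − ξ∘s. Then ι* is an involution (ι*∘ι* = id), and the annihilator of the graph {(x, ι(x)) : x ∈ E} in (E*)², with respect to the pairing ((x, y), (ξ, η)) ↦ ξ(x) + η(y), equals the graph {(ξ, ι*(ξ)) : ξ ∈ E*}. (This is the k = 2 case, over a single unit, of the paper's identity U²(E*) = U²(E)^⊥ for the dual VB-groupoid.) -/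
/-- Let `ι x = r x + s x - x` and `ι* ξ = ξ - ξ∘r - ξ∘s`. Then `ι*` is an involution and
the annihilator of the graph of `ι` in `(E*)²`, with respect to the pairing
`((x,y),(ξ,η)) ↦ ξ x + η y`, is the graph of `ι*`. -/
theorem stmt_12 (K : Type*) [Field K] (E : Type*) [AddCommGroup E] [Module K E]
    (F : Submodule K E) (r s : E →ₗ[K] E)
    (hr : ∀ x : E, r x ∈ F) (hs : ∀ x : E, s x ∈ F)
    (hrF : ∀ f ∈ F, r f = f) (hsF : ∀ f ∈ F, s f = f) :
    let ιs : Module.Dual K E → Module.Dual K E := fun ξ => ξ - ξ ∘ₗ r - ξ ∘ₗ s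
    (∀ ξ : Module.Dual K E, ιs (ιs ξ) = ξ) ∧
    {p : Module.Dual K E × Module.Dual K E | ∀ x : E, p.1 x + p.2 (r x + s x - x) = 0} =
      {p : Module.Dual K E × Module.Dual K E | p.2 = ιs p.1} := by
  intro ιs
  have apply_ιs (ξ : Module.Dual K E) (x : E) : ιs ξ x = ξ x - ξ (r x) - ξ (s x) := rfl
  have involutive (ξ : Module.Dual K E) : ιs (ιs ξ) = ξ := by
    ext x
    simp only [apply_ιs, hrF _ (hr x), hrF _ (hs x), hsF _ (hr x), hsF _ (hs x)]
    ring
  refine ⟨involutive, ?_⟩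
  ext ⟨ξ, η⟩
  have annihilates_iff : (∀ x : E, ξ x + η (r x + s x - x) = 0) ↔ ξ = ιs η := by
    rw [LinearMap.ext_iff]
    refine forall_congr' fun x => ?_
    rw [apply_ιs, ← sub_eq_zero (a := ξ x), map_sub, map_add]
    ring_nf
  simp only [Set.mem_ofPred_eq, annihilates_iff]
  constructor
  · rintro rfl
    exact (involutive η).symm
  · rintro rfl
    exact (involutive ξ).symm
end

section
/- Assume that (x, x, x) ∈ U³ for every x ∈ U¹, that the first projection (x, y, z) ↦ x is a bijection from R onto G, and that the set U² := {(x, y) ∈ G × G : (x, y, z) ∈ U³ for some z ∈ U¹} is invariant under the swap (x, y) ↦ (y, x). Then there is a unique map ι : G → G such that U² = {(x, ι(x)) : x ∈ G}; moreover ι∘ι = id_G and ι(x) = x for every x ∈ U¹. -/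
/-- If `(x,x,x) ∈ U³` for `x ∈ U¹`, the first projection is a bijection from
`R = {(x,y,z) ∈ U³ : z ∈ U¹}` onto `G`, and
`U² = {(x,y) : ∃ z ∈ U¹, (x,y,z) ∈ U³}` is invariant under the swap, then there is a
unique map `ι : G → G` with `U² = {(x, ι x)}`; moreover `ι ∘ ι = id` and `ι` fixes `U¹`. -/
theorem stmt_13 (G : Type*) (U1 : Set G) (U3 : Set (G × G × G))
    (h2 : ∀ x ∈ U1, (x, x, x) ∈ U3)
    (hinj : ∀ t ∈ U3, t.2.2 ∈ U1 → ∀ t' ∈ U3, t'.2.2 ∈ U1 → t.1 = t'.1 → t = t')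
    (hsurj : ∀ x : G, ∃ t ∈ U3, t.2.2 ∈ U1 ∧ t.1 = x)
    (hswap : ∀ x y : G, (∃ z ∈ U1, (x, y, z) ∈ U3) → ∃ z ∈ U1, (y, x, z) ∈ U3) :
    (∃! ι : G → G,
      {p : G × G | ∃ z ∈ U1, (p.1, p.2, z) ∈ U3} = {p : G × G | p.2 = ι p.1}) ∧
    ∀ ι : G → G,
      {p : G × G | ∃ z ∈ U1, (p.1, p.2, z) ∈ U3} = {p : G × G | p.2 = ι p.1} →
      (∀ x : G, ι (ι x) = x) ∧ ∀ x ∈ U1, ι x = x := by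
  have mem_iff : ∀ ι : G → G,
      {p : G × G | ∃ z ∈ U1, (p.1, p.2, z) ∈ U3} = {p : G × G | p.2 = ι p.1} →
      ∀ x y : G, (∃ z ∈ U1, (x, y, z) ∈ U3) ↔ y = ι x :=
    fun ι h x y => Set.ext_iff.mp h (x, y)
  refine ⟨?_, fun ι h => ⟨fun x => ?_, fun x hx => ?_⟩⟩
  · choose f hf hf1 hfx using hsurj
    have hmem : ∀ x, (x, (f x).2.1, (f x).2.2) ∈ U3 := fun x => by
      have heq : (x, (f x).2.1, (f x).2.2) = f x := Prod.ext (hfx x).symm rfl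
      rw [heq]
      exact hf x
    refine ⟨fun x => (f x).2.1, ?_, fun κ hκ => funext fun x => ?_⟩
    · ext ⟨x, y⟩
      constructor
      · rintro ⟨z, hz, h⟩
        exact congrArg (fun t => t.2.1) (hinj _ h hz _ (hf x) (hf1 x) (hfx x).symm)
      · rintro (rfl : y = (f x).2.1)
        exact ⟨(f x).2.2, hf1 x, hmem x⟩
    · exact ((mem_iff κ hκ x _).mp ⟨(f x).2.2, hf1 x, hmem x⟩).symm
  · exact ((mem_iff ι h _ _).mp (hswap _ _ ((mem_iff ι h x _).mpr rfl))).symm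
  · exact ((mem_iff ι h x x).mp ⟨x, hx, h2 x hx⟩).symm
end

section
/- Assume: (1) if (x, y, z) ∈ U³ then (z, x, y) ∈ U³; (2) (x, x, x) ∈ U³ for every x ∈ U¹; (3) the map (x, y, z) ↦ (x, y) is injective on U³; (4) the first projection (x, y, z) ↦ x is a bijection from R onto G, and U² := {(x, y) : (x, y, z) ∈ U³ for some z ∈ U¹} is invariant under (x, y) ↦ (y, x); (5) the set U⁴ := {(x, y, z, t) ∈ G⁴ : there exists (u, v) ∈ U² with (x, y, v) ∈ U³ and (u, z, t) ∈ U³} is invariant under the cyclic permutation (x, y, z, t) ↦ (t, x, y, z). Then there exist maps r, s, ι : G → G and a partial product assigning to each pair (x, y) with s(x) = r(y) an element x·y ∈ G, such that: r(x) ∈ U¹ and s(x) ∈ U¹ for all x ∈ G; x ∈ U¹ if and only if r(x) = x, and r(x) = x = s(x) for every x ∈ U¹; r(x·y) = r(x) and s(x·y) = s(y) whenever s(x) = r(y); (x·y)·z = x·(y·z) whenever s(x) = r(y) and s(y) = r(z); r(x)·x = x = x·s(x) for every x ∈ G; r(ι(x)) = s(x), s(ι(x)) = r(x), x·ι(x)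 = r(x) and ι(x)·x = s(x) for every x ∈ G; and U³ = {(x, y, z) ∈ G³ : s(x) = r(y) and z = ι(x·y)}. -/
/-- Existence part of the characterization of groupoids via units and triples composable
to a unit: under conditions (1)-(5) on `U¹ ⊆ G` and `U³ ⊆ G³` there are maps
`r, s, ι : G → G` and a product `m` (defined on pairs with `s x = r y`) making `G` a
groupoid with units `U¹`, inverse `ι`, and
`U³ = {(x,y,z) : s x = r y and z = (x·y)⁻¹}`. -/
theorem stmt_14 (G : Type*) (U1 : Set G) (U3 : Set (G × G × G))
    (h1 : ∀ t ∈ U3, (t.2.2, t.1, t.2.1) ∈ U3)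
    (h2 : ∀ x ∈ U1, (x, x, x) ∈ U3)
    (h3 : ∀ t ∈ U3, ∀ t' ∈ U3, t.1 = t'.1 → t.2.1 = t'.2.1 → t = t')
    (h4inj : ∀ t ∈ U3, t.2.2 ∈ U1 → ∀ t' ∈ U3, t'.2.2 ∈ U1 → t.1 = t'.1 → t = t')
    (h4surj : ∀ x : G, ∃ t ∈ U3, t.2.2 ∈ U1 ∧ t.1 = x)
    (h4swap : ∀ x y : G, (∃ z ∈ U1, (x, y, z) ∈ U3) → ∃ z ∈ U1, (y, x, z) ∈ U3)
    (h5 : ∀ x y z t : G,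
      (∃ u v : G, (∃ w ∈ U1, (u, v, w) ∈ U3) ∧ (x, y, v) ∈ U3 ∧ (u, z, t) ∈ U3) →
      (∃ u v : G, (∃ w ∈ U1, (u, v, w) ∈ U3) ∧ (t, x, v) ∈ U3 ∧ (u, y, z) ∈ U3)) :
    ∃ (r s ι : G → G) (m : G → G → G),
      (∀ x : G, r x ∈ U1 ∧ s x ∈ U1) ∧
      (∀ x : G, x ∈ U1 ↔ r x = x) ∧
      (∀ x ∈ U1, r x = x ∧ s x = x) ∧
      (∀ x y : G, s x = r y → r (m x y) = r x ∧ s (m x y) = s y) ∧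
      (∀ x y z : G, s x = r y → s y = r z → m (m x y) z = m x (m y z)) ∧
      (∀ x : G, m (r x) x = x ∧ m x (s x) = x) ∧
      (∀ x : G, r (ι x) = s x ∧ s (ι x) = r x ∧ m x (ι x) = r x ∧ m (ι x) x = s x) ∧
      U3 = {t : G × G × G | s t.1 = r t.2.1 ∧ t.2.2 = ι (m t.1 t.2.1)} := by
  classical
  have cyc : ∀ {x y z : G}, (x, y, z) ∈ U3 → (z, x, y) ∈ U3 := fun h => h1 _ h
  have det : ∀ {x y z z' : G}, (x, y, z) ∈ U3 → (x, y, z') ∈ U3 → z = z' := fun h h' =>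
    congrArg (fun t => t.2.2) (h3 _ h _ h' rfl rfl)
  have exUnit : ∀ x : G, ∃ y z : G, (x, y, z) ∈ U3 ∧ z ∈ U1 := by
    intro x
    obtain ⟨⟨a, b, c⟩, h, hc, rfl⟩ := h4surj x
    exact ⟨b, c, h, hc⟩
  choose ι r hT hr using exUnit
  have uniq : ∀ {x y z : G}, (x, y, z) ∈ U3 → z ∈ U1 → y = ι x ∧ z = r x := by
    intro x y z h hz
    have := h4inj _ h hz _ (hT x) (hr x) rfl
    simpa using this
  have inv_inv : ∀ x, ι (ι x) = x := by
    intro x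
    obtain ⟨z, hz, h⟩ := h4swap _ _ ⟨r x, hr x, hT x⟩
    exact (uniq h hz).1.symm
  have ι_unit : ∀ {x}, x ∈ U1 → ι x = x := fun hx => (uniq (h2 _ hx) hx).1.symm
  have r_unit : ∀ {x}, x ∈ U1 → r x = x := fun hx => (uniq (h2 _ hx) hx).2.symm
  have hS : ∀ x, (ι x, x, r (ι x)) ∈ U3 := by
    intro x
    simpa only [inv_inv] using hT (ι x)
  have shift : ∀ {x y z t u : G}, (x, y, ι u) ∈ U3 → (u, z, t) ∈ U3 →
      ∃ u', (t, x, ι u') ∈ U3 ∧ (u', y, z) ∈ U3 := by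
    intro x y z t u h h'
    obtain ⟨u', v', ⟨w, hw, h₁⟩, h₂, h₃⟩ := h5 x y z t ⟨u, ι u, ⟨r u, hr u, hT u⟩, h, h'⟩
    obtain rfl := (uniq h₁ hw).1
    exact ⟨u', h₂, h₃⟩
  have src_eq : ∀ {x y z : G}, (x, y, z) ∈ U3 → r (ι x) = r y := by
    intro x y z h
    obtain ⟨u, h₁, h₂⟩ :=
      shift (x := y) (y := z) (u := ι x) (by rw [inv_inv]; exact cyc (cyc h)) (hS x)
    have hu : y = u := det (cyc h) (cyc (cyc h₂))
    subst hu
    exact det (cyc (cyc h₁)) (hT y)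
  have exTriple : ∀ {x y : G}, r (ι x) = r y → ∃ z, (x, y, z) ∈ U3 := by
    intro x y h
    have h₁ : (ι x, x, ι (r y)) ∈ U3 := by
      rw [ι_unit (hr y), ← h]
      exact hS x
    obtain ⟨u, h₂, h₃⟩ := shift h₁ (cyc (hT y))
    exact ⟨u, cyc (cyc h₃)⟩
  let m : G → G → G := fun x y => if h : ∃ z, (x, y, z) ∈ U3 then ι h.choose else x
  have m_eq : ∀ {x y z : G}, (x, y, z) ∈ U3 → m x y = ι z := by
    intro x y z h
    have hex : ∃ z, (x, y, z) ∈ U3 := ⟨z, h⟩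
    simp only [m, dif_pos hex]
    rw [det hex.choose_spec h]
  have m_mem : ∀ {x y : G}, r (ι x) = r y → (x, y, ι (m x y)) ∈ U3 := by
    intro x y h
    obtain ⟨z, hz⟩ := exTriple h
    rwa [m_eq hz, inv_inv]
  have r_mul : ∀ {x y : G}, r (ι x) = r y → r (m x y) = r x := by
    intro x y h
    simpa only [inv_inv] using src_eq (cyc (m_mem h))
  have s_mul : ∀ {x y : G}, r (ι x) = r y → r (ι (m x y)) = r (ι y) := fun h =>
    (src_eq (cyc (cyc (m_mem h)))).symm
  refine ⟨r, fun x => r (ι x), ι, m, fun x => ⟨hr x, hr _⟩,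
    fun x => ⟨r_unit, fun h => h ▸ hr x⟩,
    fun x hx => ⟨r_unit hx, by simp only [ι_unit hx, r_unit hx]⟩,
    fun x y h => ⟨r_mul h, s_mul h⟩, ?_, ?_, ?_, ?_⟩
  · intro x y z hxy hyz
    obtain ⟨u, h₁, h₂⟩ := shift (m_mem hxy) (m_mem ((s_mul hxy).trans hyz))
    obtain ⟨v, h₃, h₄⟩ := shift h₁ h₂
    obtain ⟨w, h₅, h₆⟩ := shift h₃ h₄
    have hw : m y z = w := by rw [m_eq h₅, inv_inv]
    subst hw
    rw [m_eq (cyc h₆), inv_inv]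
  · intro x
    refine ⟨?_, ?_⟩
    · rw [m_eq (cyc (hT x)), inv_inv]
    · rw [m_eq (cyc (cyc (hS x))), inv_inv]
  · intro x
    refine ⟨rfl, by simp only [inv_inv], ?_, ?_⟩
    · rw [m_eq (hT x), ι_unit (hr x)]
    · rw [m_eq (hS x), ι_unit (hr _)]
  · ext ⟨x, y, z⟩
    refine ⟨fun h => ⟨src_eq h, ?_⟩, ?_⟩
    · simp only [m_eq h, inv_inv]
    · rintro ⟨h, hz⟩
      simp only at h hz
      rw [hz]
      exact m_mem h
end

section
/- Suppose (r, s, ι, ·) and (r', s', ι', ·') are two families of data on G, each consisting of maps r, s, ι : G → G together with a partial product defined exactly on the pairs (x, y) with s(x) = r(y) (respectively s'(x) = r'(y)), and each satisfying all of the following: r(x) = x = s(x) for every x ∈ U¹, and r(x), s(x) ∈ U¹ for all x ∈ G; r(x·y) = r(x) and s(x·y) = s(y) whenever s(x) = r(y); (x·y)·z = x·(y·z) whenever s(x) = r(y) and s(y) = r(z); r(x)·x = x = x·s(x); r(ι(x)) = s(x), s(ι(x)) = r(x), x·ι(x) = r(x), ι(x)·x = s(x); and U³ = {(x, y, z) ∈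 G³ : s(x) = r(y) and z = ι(x·y)} (respectively the same conditions with primes). Then r = r', s = s', ι = ι', and for all x, y ∈ G one has s(x) = r(y) if and only if s'(x) = r'(y), in which case x·y = x·'y. (This is the uniqueness part of the paper's characterization of groupoid structures via the sets U¹ and U³ of units and of triples composable to a unit.) -/
/-- Uniqueness part of the characterization of groupoid structures via the sets `U¹` of
units and `U³` of triples composable to a unit: two groupoid-structure data
`(r, s, ι, m)` and `(r', s', ι', m')` on `G` satisfying the listed axioms (with the same
`U¹` and `U³`) coincide: `r = r'`, `s = s'`, `ι = ι'`, composability agrees, and the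
products agree on composable pairs. -/
theorem stmt_15 (G : Type*) (U1 : Set G) (U3 : Set (G × G × G))
    (r s ι : G → G) (m : G → G → G)
    (r' s' ι' : G → G) (m' : G → G → G)
    (hA1 : ∀ x ∈ U1, r x = x ∧ s x = x)
    (hA2 : ∀ x : G, r x ∈ U1 ∧ s x ∈ U1)
    (hA3 : ∀ x y : G, s x = r y → r (m x y) = r x ∧ s (m x y) = s y)
    (hA4 : ∀ x y z : G, s x = r y → s y = r z → m (m x y) z = m x (m y z))
    (hA5 : ∀ x : G, m (r x) x = x ∧ m x (s x) = x)
    (hA6 : ∀ x : G, r (ι x) = s x ∧ s (ι x) = r x ∧ m x (ι x) = r x ∧ m (ι x) x = s x)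
    (hA7 : U3 = {t : G × G × G | s t.1 = r t.2.1 ∧ t.2.2 = ι (m t.1 t.2.1)})
    (hB1 : ∀ x ∈ U1, r' x = x ∧ s' x = x)
    (hB2 : ∀ x : G, r' x ∈ U1 ∧ s' x ∈ U1)
    (hB3 : ∀ x y : G, s' x = r' y → r' (m' x y) = r' x ∧ s' (m' x y) = s' y)
    (hB4 : ∀ x y z : G, s' x = r' y → s' y = r' z → m' (m' x y) z = m' x (m' y z))
    (hB5 : ∀ x : G, m' (r' x) x = x ∧ m' x (s' x) = x)
    (hB6 : ∀ x : G,
      r' (ι' x) = s' x ∧ s' (ι' x) = r' x ∧ m' x (ι' x) = r' x ∧ m' (ι' x) x = s' x)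
    (hB7 : U3 = {t : G × G × G | s' t.1 = r' t.2.1 ∧ t.2.2 = ι' (m' t.1 t.2.1)}) :
    r = r' ∧ s = s' ∧ ι = ι' ∧
    (∀ x y : G, s x = r y ↔ s' x = r' y) ∧
    (∀ x y : G, s x = r y → m x y = m' x y) := by
  have comp_iff : ∀ x y z : G,
      (s x = r y ∧ z = ι (m x y)) ↔ (s' x = r' y ∧ z = ι' (m' x y)) := fun x y z => by
    have h := Set.ext_iff.mp (hA7.symm.trans hB7) (x, y, z)
    simpa only [Set.mem_ofPred_eq] using h
  have hr : ∀ x, r x = r' x := fun x =>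
    (hB1 _ (hA2 x).1).2.symm.trans
      ((comp_iff (r x) x _).mp ⟨(hA1 _ (hA2 x).1).2, rfl⟩).1
  have hs_unit : ∀ x, s x = r (s x) := fun x => (hA1 _ (hA2 x).2).1.symm
  have hs : ∀ x, s x = s' x := fun x =>
    (hB1 _ (hA2 x).2).1.symm.trans
      ((comp_iff x (s x) _).mp ⟨hs_unit x, rfl⟩).1.symm
  have hι : ∀ x, ι x = ι' x := fun x => by
    have h := ((comp_iff x (s x) _).mp ⟨hs_unit x, rfl⟩).2
    rwa [(hA5 x).2, hs, (hB5 x).2] at h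
  have ι_invol : Function.Involutive ι := fun x => by
    have h := hA4 x (ι x) (ι (ι x)) (hA6 x).1.symm (hA6 (ι x)).1.symm
    rwa [(hA6 x).2.2.1, (hA6 (ι x)).2.2.1, (hA6 x).1, (hA5 x).2, ← (hA6 x).2.1,
      ← (hA6 (ι x)).1, (hA5 _).1] at h
  refine ⟨funext hr, funext hs, funext hι, fun x y => by rw [hs, hr], fun x y hxy => ?_⟩
  apply ι_invol.injective
  rw [hι (m' x y)]
  exact ((comp_iff x y _).mp ⟨hxy, rfl⟩).2
end

section
/- Let n, l, k ∈ ℕ and let f ∈ 𝒮(ℝⁿ × ℝˡ × ℝᵏ) be a Schwartz function. Define g : ℝⁿ → ℂ by g(x) = ∫_{ℝˡ} f(x, y, 0) dy. Then for every ξ ∈ ℝⁿ all the integrals involved converge absolutely and 𝓕g(ξ) = ∫_{ℝᵏ} 𝓕f(ξ, 0, η) dη. (This is the coordinate form, to which the paper reduces, of its claim that for a subspace H ⊆ F₁ × F₂ with injective first projection and surjective second projection, the push–pull operator q_H = (p₂)_! ∘ p₁* on Schwartz functions satisfies 𝓕 ∘ q_H = q_{H^⊥} ∘ 𝓕.) 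-/
open MeasureTheory RealInnerProductSpace FourierTransform SchwartzMap

section

variable {V W : Type*} [NormedAddCommGroup V] [NormedSpace ℝ V]
  [NormedAddCommGroup W] [NormedSpace ℝ W]

/-- A Schwartz function decays faster than any power of `1 + ‖v‖`. -/
lemma SchwartzMap.exists_norm_le_one_add_norm_rpow (f : 𝓢(V, ℂ)) (N : ℕ) :
    ∃ C : ℝ, 0 ≤ C ∧ ∀ v, ‖f v‖ ≤ C * (1 + ‖v‖) ^ (-(N : ℝ)) := by
  refine ⟨2 ^ N * (Finset.Iic (N, 0)).sup (fun m => SchwartzMap.seminorm ℝ m.1 m.2) f,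
    by positivity, fun v => ?_⟩
  have h := one_add_le_sup_seminorm_apply (𝕜 := ℝ) (m := (N, 0)) le_rfl le_rfl f v
  rw [norm_iteratedFDeriv_zero] at h
  have hp : (0 : ℝ) < (1 + ‖v‖) ^ N := by positivity
  rw [Real.rpow_neg (by positivity), Real.rpow_natCast, ← div_eq_mul_inv, le_div_iff₀ hp]
  linarith

/-- There is an integrable function `b` on `W` that bounds `f v` by `b w` whenever `‖w‖ ≤ ‖v‖`. -/
lemma SchwartzMap.exists_integrable_bound [FiniteDimensional ℝ W] [MeasurableSpace W]
    [BorelSpace W] (μ : Measure W) [μ.IsAddHaarMeasure] (f : 𝓢(V, ℂ)) :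
    ∃ b : W → ℝ, Integrable b μ ∧ ∀ w v, ‖w‖ ≤ ‖v‖ → ‖f v‖ ≤ b w := by
  obtain ⟨C, hC, h⟩ := f.exists_norm_le_one_add_norm_rpow (Module.finrank ℝ W + 1)
  refine ⟨fun w => C * (1 + ‖w‖) ^ (-((Module.finrank ℝ W + 1 : ℕ) : ℝ)),
    (integrable_one_add_norm (by push_cast; linarith)).const_mul C, fun w v hwv => ?_⟩
  refine (h v).trans (mul_le_mul_of_nonneg_left ?_ hC)
  exact Real.rpow_le_rpow_of_nonpos (by positivity) (by linarith) (neg_nonpos.2 (Nat.cast_nonneg _))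

/-- The restriction of a Schwartz function along a continuous map that does not decrease the norm
is integrable. -/
lemma SchwartzMap.integrable_comp [FiniteDimensional ℝ W] [MeasurableSpace W]
    [BorelSpace W] (μ : Measure W) [μ.IsAddHaarMeasure] (f : 𝓢(V, ℂ)) {a : W → V}
    (ha : Continuous a) (hn : ∀ w, ‖w‖ ≤ ‖a w‖) : Integrable (fun w => f (a w)) μ := by
  obtain ⟨b, hb, hfb⟩ := f.exists_integrable_bound μ
  exact hb.mono' (f.continuous.comp ha).aestronglyMeasurable
    (Filter.Eventually.of_forall fun w => hfb w _ (hn w))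

end

lemma norm_cexp_neg_two_pi_I_mul (t : ℝ) :
    ‖Complex.exp (-2 * Real.pi * Complex.I * (t : ℂ))‖ = 1 := by
  rw [Complex.norm_exp]
  simp

lemma MeasureTheory.Integrable.mul_cexp {W : Type*} [TopologicalSpace W] [MeasurableSpace W]
    [OpensMeasurableSpace W] {μ : Measure W} {φ : W → ℂ} (hφ : Integrable φ μ)
    {θ : W → ℝ} (hθ : Continuous θ) :
    Integrable (fun w => φ w * Complex.exp (-2 * Real.pi * Complex.I * (θ w : ℂ))) μ := by
  refine hφ.mul_bdd (c := 1) (Continuous.aestronglyMeasurable (by fun_prop))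
    (Filter.Eventually.of_forall fun w => ?_)
  rw [norm_cexp_neg_two_pi_I_mul]

lemma fourier_eq_integral_mul_cexp {W : Type*} [NormedAddCommGroup W] [InnerProductSpace ℝ W]
    [FiniteDimensional ℝ W] [MeasurableSpace W] [BorelSpace W] (φ : W → ℂ) (w : W) :
    𝓕 φ w = ∫ v, φ v * Complex.exp (-2 * Real.pi * Complex.I * ((⟪v, w⟫ : ℝ) : ℂ)) := by
  rw [Real.fourier_eq']
  refine integral_congr_ae (Filter.Eventually.of_forall fun v => ?_)
  simp only [smul_eq_mul]
  rw [mul_comm]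
  congr 2
  push_cast
  ring

section

variable {E F G : Type*}
  [NormedAddCommGroup E] [InnerProductSpace ℝ E] [FiniteDimensional ℝ E]
  [MeasurableSpace E] [BorelSpace E]
  [NormedAddCommGroup F] [InnerProductSpace ℝ F] [FiniteDimensional ℝ F]
  [MeasurableSpace F] [BorelSpace F]
  [NormedAddCommGroup G] [InnerProductSpace ℝ G]

lemma SchwartzMap.integrable_slice_mul_cexp (f : 𝓢(E × F × G, ℂ)) (ξ : E) (z : G) :
    Integrable fun p : E × F =>
      f (p.1, p.2, z) * Complex.exp (-2 * Real.pi * Complex.I * ((⟪p.1, ξ⟫ : ℝ) : ℂ)) := by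
  refine Integrable.mul_cexp (f.integrable_comp (Measure.prod volume volume)
    (a := fun p : E × F => (p.1, p.2, z)) (by fun_prop) fun p => ?_) (by fun_prop)
  simp only [Prod.norm_def]
  exact max_le_max le_rfl (le_max_left _ _)

/-- The partial Fourier transform of `f` in the first variable at `ξ`, integrated over the second
variable. -/
noncomputable def partialFourierIntegral (f : 𝓢(E × F × G, ℂ)) (ξ : E) (z : G) : ℂ :=
  ∫ p : E × F, f (p.1, p.2, z) *
    Complex.exp (-2 * Real.pi * Complex.I * ((⟪p.1, ξ⟫ : ℝ) : ℂ))

lemma continuous_partialFourierIntegral (f : 𝓢(E × F × G, ℂ)) (ξ : E) :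
    Continuous (partialFourierIntegral f ξ) := by
  obtain ⟨b, hb, hfb⟩ := f.exists_integrable_bound (W := E × F) (Measure.prod volume volume)
  refine continuous_of_dominated (bound := b)
    (fun z => (f.integrable_slice_mul_cexp ξ z).aestronglyMeasurable)
    (fun z => Filter.Eventually.of_forall fun p => ?_) hb
    (Filter.Eventually.of_forall fun p => ?_)
  · rw [norm_mul, norm_cexp_neg_two_pi_I_mul, mul_one]
    refine hfb p _ ?_
    simp only [Prod.norm_def]
    exact max_le_max le_rfl (le_max_left _ _)
  · exact (f.continuous.comp (by fun_prop)).mul continuous_const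

variable [FiniteDimensional ℝ G] [MeasurableSpace G] [BorelSpace G]

variable (E F G) in
/-- The identification of the Hilbert sum of three spaces with their product. -/
noncomputable def hilbertSumEquivProd : WithLp 2 (E × WithLp 2 (F × G)) ≃L[ℝ] E × F × G :=
  (WithLp.prodContinuousLinearEquiv 2 ℝ E (WithLp 2 (F × G))).trans
    ((ContinuousLinearEquiv.refl ℝ E).prodCongr (WithLp.prodContinuousLinearEquiv 2 ℝ F G))

lemma measurePreserving_hilbertSumEquivProd :
    MeasurePreserving (hilbertSumEquivProd E F G) := by
  have h := ((MeasurePreserving.id (volume : Measure E)).prod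
    (WithLp.volume_preserving_ofLp F G)).comp
    (WithLp.volume_preserving_ofLp E (WithLp 2 (F × G)))
  exact h

lemma SchwartzMap.integrable_integral_mul_cexp_prod (f : 𝓢(E × F × G, ℂ)) (ξ : E) :
    Integrable fun η : G => ∫ v : E × F × G, f v * Complex.exp (-2 * Real.pi * Complex.I *
      ((⟪v.1, ξ⟫ + ⟪v.2.1, (0 : F)⟫ + ⟪v.2.2, η⟫ : ℝ) : ℂ)) := by
  set L := hilbertSumEquivProd E F G
  let f' : 𝓢(WithLp 2 (E × WithLp 2 (F × G)), ℂ) := compCLMOfContinuousLinearEquiv ℂ L f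
  have key : ∀ η : G, ∫ v : E × F × G, f v * Complex.exp (-2 * Real.pi * Complex.I *
      ((⟪v.1, ξ⟫ + ⟪v.2.1, (0 : F)⟫ + ⟪v.2.2, η⟫ : ℝ) : ℂ)) = (𝓕 f') (L.symm (ξ, 0, η)) := by
    intro η
    rw [fourier_coe, fourier_eq_integral_mul_cexp,
      ← measurePreserving_hilbertSumEquivProd.integral_comp
        L.toHomeomorph.measurableEmbedding]
    refine integral_congr_ae (Filter.Eventually.of_forall fun v => ?_)
    simp only [WithLp.prod_inner_apply]
    rw [add_assoc]
    rfl
  simp only [key]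
  refine (𝓕 f').integrable_comp volume (L.symm.continuous.comp (by fun_prop)) fun η => ?_
  have h1 := WithLp.norm_snd_le (p := 2) (x := L.symm (ξ, 0, η))
  have h2 := WithLp.norm_snd_le (p := 2) (x := (L.symm (ξ, 0, η)).snd)
  exact h2.trans h1

lemma SchwartzMap.integrable_mul_cexp (f : 𝓢(E × F × G, ℂ)) {θ : E × F × G → ℝ}
    (hθ : Continuous θ) :
    Integrable fun v => f v * Complex.exp (-2 * Real.pi * Complex.I * (θ v : ℂ)) := by
  have : (volume : Measure (F × G)).IsAddHaarMeasure := Measure.prod.instIsAddHaarMeasure _ _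
  exact Integrable.mul_cexp (f.integrable_comp (Measure.prod volume volume)
    continuous_id fun _ => le_rfl) hθ

lemma measurePreserving_volume_prodAssoc :
    MeasurePreserving (MeasurableEquiv.prodAssoc : (E × F) × G ≃ᵐ E × F × G) :=
  measurePreserving_prodAssoc volume volume volume

lemma integrable_partialFourierIntegral (f : 𝓢(E × F × G, ℂ)) (ξ : E) :
    Integrable (partialFourierIntegral f ξ) := by
  have h := (f.integrable_mul_cexp (θ := fun v => ⟪v.1, ξ⟫) (by fun_prop))
  have h' := (measurePreserving_volume_prodAssoc (E := E) (F := F) (G := G)).integrable_comp_emb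
    MeasurableEquiv.prodAssoc.measurableEmbedding |>.2 h
  exact h'.integral_prod_right

lemma fourier_partialFourierIntegral (f : 𝓢(E × F × G, ℂ)) (ξ : E) (η : G) :
    𝓕 (partialFourierIntegral f ξ) η =
      ∫ v : E × F × G, f v * Complex.exp (-2 * Real.pi * Complex.I *
        ((⟪v.1, ξ⟫ + ⟪v.2.1, (0 : F)⟫ + ⟪v.2.2, η⟫ : ℝ) : ℂ)) := by
  have h := f.integrable_mul_cexp
    (θ := fun v => ⟪v.1, ξ⟫ + ⟪v.2.1, (0 : F)⟫ + ⟪v.2.2, η⟫) (by fun_prop)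
  have hmp := measurePreserving_volume_prodAssoc (E := E) (F := F) (G := G)
  have h' := (hmp.integrable_comp_emb MeasurableEquiv.prodAssoc.measurableEmbedding).2 h
  rw [← hmp.integral_comp MeasurableEquiv.prodAssoc.measurableEmbedding]
  refine Eq.trans ?_ (integral_prod_symm _ h').symm
  rw [fourier_eq_integral_mul_cexp]
  refine integral_congr_ae (Filter.Eventually.of_forall fun z => ?_)
  simp only [partialFourierIntegral]
  rw [← integral_mul_const]
  refine integral_congr_ae (Filter.Eventually.of_forall fun p => ?_)
  simp only [Function.comp_apply, MeasurableEquiv.prodAssoc, MeasurableEquiv.coe_mk,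
    Equiv.prodAssoc_apply, inner_zero_right, add_zero]
  rw [mul_assoc, ← Complex.exp_add]
  congr 2
  push_cast
  ring

lemma partialFourierIntegral_eq_integral_fourier (f : 𝓢(E × F × G, ℂ)) (ξ : E) :
    partialFourierIntegral f ξ 0 =
      ∫ η : G, ∫ v : E × F × G, f v * Complex.exp (-2 * Real.pi * Complex.I *
        ((⟪v.1, ξ⟫ + ⟪v.2.1, (0 : F)⟫ + ⟪v.2.2, η⟫ : ℝ) : ℂ)) := by
  have h := (continuous_partialFourierIntegral f ξ).fourierInv_fourier_eq
    (integrable_partialFourierIntegral f ξ) (by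
      have := f.integrable_integral_mul_cexp_prod ξ
      simp only [← fourier_partialFourierIntegral] at this
      exact this)
  rw [← congrFun h 0, Real.fourierInv_eq']
  simp [fourier_partialFourierIntegral]

end

/-- Let `f` be a Schwartz function on `ℝⁿ × ℝˡ × ℝᵏ` (with the product Euclidean inner
product and Lebesgue measure) and `g x = ∫_{ℝˡ} f (x, y, 0) dy`. Then for every `ξ` all
the integrals involved converge absolutely and `𝓕 g (ξ) = ∫_{ℝᵏ} 𝓕 f (ξ, 0, η) dη`,
where the Fourier transform is normalized as `𝓕 f (ξ) = ∫ f x exp (-2πi ⟨x, ξ⟩) dx`. -/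
theorem stmt_16 (n l k : ℕ)
    (f : SchwartzMap
      (EuclideanSpace ℝ (Fin n) × EuclideanSpace ℝ (Fin l) × EuclideanSpace ℝ (Fin k)) ℂ)
    (g : EuclideanSpace ℝ (Fin n) → ℂ)
    (hg : ∀ x : EuclideanSpace ℝ (Fin n), g x = ∫ y : EuclideanSpace ℝ (Fin l), f (x, y, 0)) :
    let Ff : EuclideanSpace ℝ (Fin n) × EuclideanSpace ℝ (Fin l) × EuclideanSpace ℝ (Fin k)
        → ℂ := fun w =>
      ∫ v : EuclideanSpace ℝ (Fin n) × EuclideanSpace ℝ (Fin l) × EuclideanSpace ℝ (Fin k),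
        f v * Complex.exp (-2 * Real.pi * Complex.I *
          ((⟪v.1, w.1⟫ + ⟪v.2.1, w.2.1⟫ + ⟪v.2.2, w.2.2⟫ : ℝ) : ℂ))
    let Fg : EuclideanSpace ℝ (Fin n) → ℂ := fun ξ =>
      ∫ x : EuclideanSpace ℝ (Fin n),
        g x * Complex.exp (-2 * Real.pi * Complex.I * ((⟪x, ξ⟫ : ℝ) : ℂ))
    ∀ ξ : EuclideanSpace ℝ (Fin n),
      (∀ x : EuclideanSpace ℝ (Fin n),
        Integrable fun y : EuclideanSpace ℝ (Fin l) => f (x, y, 0)) ∧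
      (Integrable fun x : EuclideanSpace ℝ (Fin n) =>
        g x * Complex.exp (-2 * Real.pi * Complex.I * ((⟪x, ξ⟫ : ℝ) : ℂ))) ∧
      (∀ w : EuclideanSpace ℝ (Fin n) × EuclideanSpace ℝ (Fin l) × EuclideanSpace ℝ (Fin k),
        Integrable fun v : EuclideanSpace ℝ (Fin n) × EuclideanSpace ℝ (Fin l) ×
            EuclideanSpace ℝ (Fin k) =>
          f v * Complex.exp (-2 * Real.pi * Complex.I *
            ((⟪v.1, w.1⟫ + ⟪v.2.1, w.2.1⟫ + ⟪v.2.2, w.2.2⟫ : ℝ) : ℂ))) ∧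
      (Integrable fun η : EuclideanSpace ℝ (Fin k) => Ff (ξ, 0, η)) ∧
      Fg ξ = ∫ η : EuclideanSpace ℝ (Fin k), Ff (ξ, 0, η) := by
  intro Ff Fg ξ
  have hslice := f.integrable_slice_mul_cexp ξ 0
  have hinner : ∀ x : EuclideanSpace ℝ (Fin n),
      (∫ y : EuclideanSpace ℝ (Fin l), f (x, y, 0) *
        Complex.exp (-2 * Real.pi * Complex.I * ((⟪x, ξ⟫ : ℝ) : ℂ))) =
      g x * Complex.exp (-2 * Real.pi * Complex.I * ((⟪x, ξ⟫ : ℝ) : ℂ)) := fun x => by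
    rw [hg x, integral_mul_const]
  refine ⟨fun x => ?_, ?_, fun w => f.integrable_mul_cexp (by fun_prop),
    f.integrable_integral_mul_cexp_prod ξ, ?_⟩
  · refine f.integrable_comp volume (a := fun y => (x, y, 0)) (by fun_prop) fun y => ?_
    exact (le_max_left _ _).trans (le_max_right _ _)
  · refine hslice.integral_prod_left.congr (Filter.Eventually.of_forall fun x => ?_)
    exact hinner x
  · refine Eq.trans ?_ (partialFourierIntegral_eq_integral_fourier f ξ)
    refine Eq.trans ?_ (integral_prod _ hslice).symm
    exact integral_congr_ae (Filter.Eventually.of_forall fun x => (hinner x).symm)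
end
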